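/- arXiv:2001.10457 — 2 statements merged into one kernel-verified Lean document; each statement's English description precedes it below -/
import Mathlib

section
/- Let k be an even integer ≥ 2, let f be a nonzero element of M_k, and let γ = (a b; c d) ∈ SL_2(Z). For every z ∈ H at which f is holomorphic with f'(z) ≠ 0 and such that c·φ_f(z) + d ≠ 0, the function f is holomorphic at γz = (az+b)/(cz+d) with f'(γz) ≠ 0, and φ_f(γz) = (a·φ_f(z) + b)/(c·φ_f(z) + d). -/
/-- The upper half-plane, as a subset of `ℂ`. -/
def UpperHalf : Set ℂ := {z : ℂ | 0 < z.im}

/-- `f` belongs to `M_k`: it is a meromorphic function on the upper half-plane (at every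
point it is either analytic or has a genuine pole, i.e. `‖f‖` blows up) satisfying
`f((az+b)/(cz+d)) = (cz+d)^k f(z)` for every `(a b; c d) ∈ SL₂(ℤ)` (asserted at every
point of the upper half-plane where both sides take honest, finite values). -/
def IsMk (k : ℕ) (f : ℂ → ℂ) : Prop :=
  (∀ z ∈ UpperHalf, MeromorphicAt f z) ∧
  (∀ z ∈ UpperHalf, AnalyticAt ℂ f z ∨
    Filter.Tendsto (fun w => ‖f w‖) (nhdsWithin z {z}ᶜ) Filter.atTop) ∧
  (∀ a b c d : ℤ, a * d - b * c = 1 → ∀ z ∈ UpperHalf,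
    AnalyticAt ℂ f z →
    AnalyticAt ℂ f (((a : ℂ) * z + (b : ℂ)) / ((c : ℂ) * z + (d : ℂ))) →
    f (((a : ℂ) * z + (b : ℂ)) / ((c : ℂ) * z + (d : ℂ))) = ((c : ℂ) * z + (d : ℂ)) ^ k * f z)

open Filter Topology

/-- The automorphy factor `cz + d` of a unimodular integer matrix does not vanish on the upper
half-plane. -/
theorem UpperHalf.denom_ne_zero {a b c d : ℤ} (hdet : a * d - b * c = 1) {z : ℂ}
    (hz : z ∈ UpperHalf) : (c : ℂ) * z + d ≠ 0 := by
  intro h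
  have him := congrArg Complex.im h
  have hre := congrArg Complex.re h
  simp at him hre
  have hc : c = 0 := him.resolve_right (ne_of_gt hz)
  subst hc
  have hd : d = 0 := by simpa using hre
  subst hd
  simp at hdet

/-- The upper half-plane is stable under the action of unimodular integer matrices. -/
theorem UpperHalf.mobius_mem {a b c d : ℤ} (hdet : a * d - b * c = 1) {z : ℂ}
    (hz : z ∈ UpperHalf) : ((a : ℂ) * z + b) / ((c : ℂ) * z + d) ∈ UpperHalf := by
  have hj := Complex.normSq_pos.mpr (UpperHalf.denom_ne_zero hdet hz)
  have hdet' : (a : ℝ) * d - b * c = 1 := by exact_mod_cast hdet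
  have hz' : 0 < z.im := hz
  have him : (((a : ℂ) * z + b) / ((c : ℂ) * z + d)).im
      = z.im / Complex.normSq ((c : ℂ) * z + d) := by
    rw [Complex.div_im, ← sub_div]
    congr 1
    simp
    linear_combination z.im * hdet'
  change 0 < (((a : ℂ) * z + b) / ((c : ℂ) * z + d)).im
  rw [him]
  positivity

/-- The derivative of a unimodular Möbius transformation is `(cz + d)⁻²`. -/
theorem hasDerivAt_mobius {a b c d : ℂ} (hdet : a * d - b * c = 1) {z : ℂ}
    (hj : c * z + d ≠ 0) :
    HasDerivAt (fun w => (a * w + b) / (c * w + d)) (1 / (c * z + d) ^ 2) z := by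
  have hnum : HasDerivAt (fun w => a * w + b) a z := by
    simpa using ((hasDerivAt_id z).const_mul a).add_const b
  have hdenom : HasDerivAt (fun w => c * w + d) c z := by
    simpa using ((hasDerivAt_id z).const_mul c).add_const d
  have hval : (a * (c * z + d) - (a * z + b) * c) = 1 := by linear_combination hdet
  simpa only [hval] using hnum.fun_div hdenom hj

theorem isOpen_upperHalf : IsOpen UpperHalf :=
  isOpen_lt continuous_const Complex.continuous_im

namespace IsMk

variable {k : ℕ} {f : ℂ → ℂ} {a b c d : ℤ} {z : ℂ}

/-- Holomorphy of `f ∈ M_k` at a point propagates along its `SL₂(ℤ)`-orbit. -/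
theorem analyticAt_mobius (hf : IsMk k f) (hdet : a * d - b * c = 1) (hz : z ∈ UpperHalf)
    (hfz : AnalyticAt ℂ f z) : AnalyticAt ℂ f (((a : ℂ) * z + b) / ((c : ℂ) * z + d)) := by
  have hj := UpperHalf.denom_ne_zero hdet hz
  have hmem := UpperHalf.mobius_mem hdet hz
  refine (hf.2.1 _ hmem).resolve_right fun hpole => ?_
  have hg := hasDerivAt_mobius (a := a) (b := b) (c := c) (d := d)
    (by exact_mod_cast hdet) hj
  have hlim := hg.tendsto_nhdsNE (one_div_ne_zero (pow_ne_zero 2 hj))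
  have hfunc : ∀ᶠ w in 𝓝[≠] z, f (((a : ℂ) * w + b) / ((c : ℂ) * w + d))
      = ((c : ℂ) * w + d) ^ k * f w := by
    filter_upwards [hlim.eventually (hf.1 _ hmem).eventually_analyticAt,
      hfz.eventually_analyticAt.filter_mono nhdsWithin_le_nhds,
      (isOpen_upperHalf.eventually_mem hz).filter_mono nhdsWithin_le_nhds] with w h1 h2 h3
    exact hf.2.2 a b c d hdet w h3 h2 h1
  have hcont : ContinuousAt (fun w => ‖((c : ℂ) * w + d) ^ k * f w‖) z := by
    have := hfz.continuousAt
    fun_prop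
  refine not_tendsto_nhds_of_tendsto_atTop (hpole.comp hlim) _
    ((hcont.tendsto.mono_left nhdsWithin_le_nhds).congr' ?_)
  filter_upwards [hfunc] with w hw
  simp [hw]

/-- The transformation law of the derivative of `f ∈ M_k`. -/
theorem deriv_mobius (hf : IsMk k f) (hdet : a * d - b * c = 1) (hz : z ∈ UpperHalf)
    (hfz : AnalyticAt ℂ f z) :
    deriv f (((a : ℂ) * z + b) / ((c : ℂ) * z + d))
      = ((c : ℂ) * z + d) ^ (k + 1) * (k * c * f z + ((c : ℂ) * z + d) * deriv f z) := by
  have hj := UpperHalf.denom_ne_zero hdet hz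
  have hg := hasDerivAt_mobius (a := a) (b := b) (c := c) (d := d)
    (by exact_mod_cast hdet) hj
  have hfunc : (fun w => f (((a : ℂ) * w + b) / ((c : ℂ) * w + d)))
      =ᶠ[𝓝 z] fun w => ((c : ℂ) * w + d) ^ k * f w := by
    filter_upwards [hfz.eventually_analyticAt, isOpen_upperHalf.eventually_mem hz] with w h1 h2
    exact hf.2.2 a b c d hdet w h2 h1 (hf.analyticAt_mobius hdet h2 h1)
  have hleft := (hf.analyticAt_mobius hdet hz hfz).differentiableAt.hasDerivAt.comp z hg
  have hdenom : HasDerivAt (fun w : ℂ => (c : ℂ) * w + d) c z := by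
    simpa using ((hasDerivAt_id z).const_mul (c : ℂ)).add_const (d : ℂ)
  have hright := (hdenom.pow k).mul hfz.differentiableAt.hasDerivAt
  have heq := hleft.unique (hright.congr_of_eventuallyEq hfunc)
  rw [mul_one_div, div_eq_iff (pow_ne_zero 2 hj)] at heq
  rw [heq]
  rcases k with _ | k <;> simp <;> ring

end IsMk

theorem stmt17 (k : ℕ) (hke : Even k) (hk2 : 2 ≤ k) (f : ℂ → ℂ) (hf : IsMk k f)
    (hf_ne : ∃ z ∈ UpperHalf, AnalyticAt ℂ f z ∧ f z ≠ 0)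
    (a b c d : ℤ) (hdet : a * d - b * c = 1)
    (z : ℂ) (hz : z ∈ UpperHalf)
    (hfz : AnalyticAt ℂ f z) (hf'z : deriv f z ≠ 0)
    (hden : (c : ℂ) * (z + (k : ℂ) * f z / deriv f z) + (d : ℂ) ≠ 0) :
    AnalyticAt ℂ f (((a : ℂ) * z + (b : ℂ)) / ((c : ℂ) * z + (d : ℂ))) ∧
    deriv f (((a : ℂ) * z + (b : ℂ)) / ((c : ℂ) * z + (d : ℂ))) ≠ 0 ∧
    (((a : ℂ) * z + (b : ℂ)) / ((c : ℂ) * z + (d : ℂ)))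
        + (k : ℂ) * f (((a : ℂ) * z + (b : ℂ)) / ((c : ℂ) * z + (d : ℂ)))
          / deriv f (((a : ℂ) * z + (b : ℂ)) / ((c : ℂ) * z + (d : ℂ)))
      = ((a : ℂ) * (z + (k : ℂ) * f z / deriv f z) + (b : ℂ))
          / ((c : ℂ) * (z + (k : ℂ) * f z / deriv f z) + (d : ℂ)) := by
  have hj := UpperHalf.denom_ne_zero hdet hz
  have hderiv := hf.deriv_mobius hdet hz hfz
  have hana := hf.analyticAt_mobius hdet hz hfz
  have hval := hf.2.2 a b c d hdet z hz hfz hana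
  have hdet' : (a : ℂ) * d - b * c = 1 := by exact_mod_cast hdet
  obtain ⟨φ, hφ⟩ : ∃ φ, φ = z + (k : ℂ) * f z / deriv f z := ⟨_, rfl⟩
  have hkf : (k : ℂ) * f z = (φ - z) * deriv f z := by
    rw [hφ]
    field_simp
    ring
  rw [← hφ] at hden ⊢
  have hderiv' : deriv f (((a : ℂ) * z + b) / ((c : ℂ) * z + d))
      = ((c : ℂ) * z + d) ^ (k + 1) * (deriv f z * (c * φ + d)) := by
    rw [hderiv]
    linear_combination ((c : ℂ) * z + d) ^ (k + 1) * c * hkf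
  refine ⟨hana, ?_, ?_⟩
  · rw [hderiv']
    exact mul_ne_zero (pow_ne_zero _ hj) (mul_ne_zero hf'z hden)
  · have hquot : (k : ℂ) * (((c : ℂ) * z + d) ^ k * f z)
        / (((c : ℂ) * z + d) ^ (k + 1) * (deriv f z * (c * φ + d)))
        = (φ - z) / (((c : ℂ) * z + d) * (c * φ + d)) := by
      rw [mul_left_comm, hkf]
      field_simp
      ring
    rw [hderiv', hval, hquot, div_add_div _ _ hj (mul_ne_zero hj hden),
      div_eq_div_iff (mul_ne_zero hj (mul_ne_zero hj hden)) hden]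
    linear_combination (z - φ) * ((c : ℂ) * z + d) * (c * φ + d) * hdet'
end

section
/- Let k be an even integer ≥ 2 and let f be a nonzero element of M_k. Define F_f(z) := (k+1)·f'(z)² − k·f(z)·f''(z). Then for every (a b; c d) ∈ SL_2(Z) and every z ∈ H at which f is holomorphic, one has F_f((az+b)/(cz+d)) = (cz+d)^{2k+4}·F_f(z); that is, F_f belongs to M_{2k+4}. -/
theorem moebius_denom_ne_zero {a b c d : ℤ} (hdet : a * d - b * c = 1) {z : ℂ}
    (hz : z ∈ UpperHalf) : (c : ℂ) * z + (d : ℂ) ≠ 0 := by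
  intro h
  have hz' : 0 < z.im := hz
  have him := congrArg Complex.im h
  have hre := congrArg Complex.re h
  simp at him hre
  rcases him with hc | hzi
  · subst hc
    have hd : d = 0 := by simpa using hre
    subst hd
    simp at hdet
  · exact hz'.ne' hzi

theorem moebius_mem_upperHalf {a b c d : ℤ} (hdet : a * d - b * c = 1) {z : ℂ}
    (hz : z ∈ UpperHalf) :
    ((a : ℂ) * z + (b : ℂ)) / ((c : ℂ) * z + (d : ℂ)) ∈ UpperHalf := by
  have hz' : 0 < z.im := hz
  have hj := Complex.normSq_pos.mpr (moebius_denom_ne_zero hdet hz)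
  have hdet' : (a : ℝ) * d - b * c = 1 := by exact_mod_cast hdet
  have him : (((a : ℂ) * z + (b : ℂ)) / ((c : ℂ) * z + (d : ℂ))).im
      = z.im / Complex.normSq ((c : ℂ) * z + (d : ℂ)) := by
    rw [Complex.div_im, ← sub_div]
    congr 1
    simp
    linear_combination z.im * hdet'
  change 0 < (((a : ℂ) * z + (b : ℂ)) / ((c : ℂ) * z + (d : ℂ))).im
  rw [him]
  exact div_pos hz' hj

theorem hasDerivAt_moebius {a b c d : ℤ} (hdet : a * d - b * c = 1) {z : ℂ}
    (hz : z ∈ UpperHalf) :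
    HasDerivAt (fun w : ℂ => ((a : ℂ) * w + (b : ℂ)) / ((c : ℂ) * w + (d : ℂ)))
      (1 / ((c : ℂ) * z + (d : ℂ)) ^ 2) z := by
  have hdet' : (a : ℂ) * d - b * c = 1 := by exact_mod_cast hdet
  have hlin (p q : ℂ) : HasDerivAt (fun w : ℂ => p * w + q) p z := by
    simpa using ((hasDerivAt_id z).const_mul p).add_const q
  refine ((hlin a b).div (hlin c d) (moebius_denom_ne_zero hdet hz)).congr_deriv ?_
  congr 1
  linear_combination hdet'

theorem tendsto_moebius_punctured {a b c d : ℤ} (hdet : a * d - b * c = 1) {z : ℂ}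
    (hz : z ∈ UpperHalf) :
    Filter.Tendsto (fun w : ℂ => ((a : ℂ) * w + (b : ℂ)) / ((c : ℂ) * w + (d : ℂ)))
      (nhdsWithin z {z}ᶜ)
      (nhdsWithin (((a : ℂ) * z + (b : ℂ)) / ((c : ℂ) * z + (d : ℂ)))
        {((a : ℂ) * z + (b : ℂ)) / ((c : ℂ) * z + (d : ℂ))}ᶜ) :=
  (hasDerivAt_moebius hdet hz).tendsto_nhdsNE
    (one_div_ne_zero (pow_ne_zero 2 (moebius_denom_ne_zero hdet hz)))

theorem eventually_mem_upperHalf {z : ℂ} (hz : z ∈ UpperHalf) : ∀ᶠ w in nhds z, w ∈ UpperHalf :=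
  (isOpen_lt continuous_const Complex.continuous_im).mem_nhds hz

/-- A point at which an element of `M_k` is analytic is carried by `SL₂(ℤ)` to another one. -/
theorem IsMk.analyticAt_moebius {k : ℕ} {f : ℂ → ℂ} (hf : IsMk k f) {a b c d : ℤ}
    (hdet : a * d - b * c = 1) {z : ℂ} (hz : z ∈ UpperHalf) (hfz : AnalyticAt ℂ f z) :
    AnalyticAt ℂ f (((a : ℂ) * z + (b : ℂ)) / ((c : ℂ) * z + (d : ℂ))) := by
  obtain ⟨hmero, hpole, hmod⟩ := hf
  have hγz := moebius_mem_upperHalf hdet hz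
  refine (hpole _ hγz).resolve_right fun hinf => ?_
  have htend := tendsto_moebius_punctured hdet hz
  have heq : ∀ᶠ w in nhdsWithin z {z}ᶜ,
      ‖f (((a : ℂ) * w + (b : ℂ)) / ((c : ℂ) * w + (d : ℂ)))‖
        = ‖((c : ℂ) * w + (d : ℂ)) ^ k * f w‖ := by
    filter_upwards [htend.eventually (hmero _ hγz).eventually_analyticAt,
      nhdsWithin_le_nhds hfz.eventually_analyticAt,
      nhdsWithin_le_nhds (eventually_mem_upperHalf hz)] with w hγw hw hwU
    rw [hmod a b c d hdet w hwU hw hγw]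
  have hcont : ContinuousAt (fun w : ℂ => ‖((c : ℂ) * w + (d : ℂ)) ^ k * f w‖) z := by
    have := hfz.continuousAt
    fun_prop
  exact not_tendsto_nhds_of_tendsto_atTop ((hinf.comp htend).congr' heq) _
    (hcont.tendsto.mono_left nhdsWithin_le_nhds)

/-- Chain rule for `g ∘ γ = h` with `γ ∈ SL₂(ℤ)`, solved for the derivative of `g` at `γ z`. -/
theorem deriv_moebius_eq {g h : ℂ → ℂ} {h' : ℂ} {a b c d : ℤ} (hdet : a * d - b * c = 1) {z : ℂ}
    (hz : z ∈ UpperHalf)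
    (hg : AnalyticAt ℂ g (((a : ℂ) * z + (b : ℂ)) / ((c : ℂ) * z + (d : ℂ))))
    (heq : ∀ᶠ w in nhds z, g (((a : ℂ) * w + (b : ℂ)) / ((c : ℂ) * w + (d : ℂ))) = h w)
    (hh : HasDerivAt h h' z) :
    deriv g (((a : ℂ) * z + (b : ℂ)) / ((c : ℂ) * z + (d : ℂ)))
      = ((c : ℂ) * z + (d : ℂ)) ^ 2 * h' := by
  have hj := moebius_denom_ne_zero hdet hz
  have hcomp := hg.differentiableAt.hasDerivAt.comp z (hasDerivAt_moebius hdet hz)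
  rw [← hcomp.unique (hh.congr_of_eventuallyEq heq), mul_left_comm, mul_one_div_cancel (pow_ne_zero 2 hj), mul_one]

theorem hasDerivAt_denom_pow_mul (c d z : ℂ) (n : ℕ) {g : ℂ → ℂ} (hg : AnalyticAt ℂ g z) :
    HasDerivAt (fun w => (c * w + d) ^ (n + 1) * g w)
      ((n + 1) * c * (c * z + d) ^ n * g z + (c * z + d) ^ (n + 1) * deriv g z) z := by
  have hlin : HasDerivAt (fun w : ℂ => c * w + d) c z := by
    simpa using ((hasDerivAt_id z).const_mul c).add_const d
  refine ((hlin.pow (n + 1)).mul hg.differentiableAt.hasDerivAt).congr_deriv ?_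
  simp only [Pi.pow_apply, Nat.add_sub_cancel, Nat.cast_add, Nat.cast_one]
  ring

theorem IsMk.deriv_moebius {k : ℕ} {f : ℂ → ℂ} (hf : IsMk (k + 1) f) {a b c d : ℤ}
    (hdet : a * d - b * c = 1) {z : ℂ} (hz : z ∈ UpperHalf) (hfz : AnalyticAt ℂ f z) :
    deriv f (((a : ℂ) * z + (b : ℂ)) / ((c : ℂ) * z + (d : ℂ)))
      = (k + 1) * c * (((c : ℂ) * z + (d : ℂ)) ^ (k + 2) * f z)
        + ((c : ℂ) * z + (d : ℂ)) ^ (k + 3) * deriv f z := by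
  have heq : ∀ᶠ w in nhds z, f (((a : ℂ) * w + (b : ℂ)) / ((c : ℂ) * w + (d : ℂ)))
      = ((c : ℂ) * w + (d : ℂ)) ^ (k + 1) * f w := by
    filter_upwards [hfz.eventually_analyticAt, eventually_mem_upperHalf hz] with w hw hwU
    exact hf.2.2 a b c d hdet w hwU hw (hf.analyticAt_moebius hdet hwU hw)
  rw [deriv_moebius_eq hdet hz (hf.analyticAt_moebius hdet hz hfz) heq
    (hasDerivAt_denom_pow_mul c d z k hfz)]
  ring

theorem IsMk.deriv_deriv_moebius {k : ℕ} {f : ℂ → ℂ} (hf : IsMk (k + 1) f) {a b c d : ℤ}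
    (hdet : a * d - b * c = 1) {z : ℂ} (hz : z ∈ UpperHalf) (hfz : AnalyticAt ℂ f z) :
    deriv (deriv f) (((a : ℂ) * z + (b : ℂ)) / ((c : ℂ) * z + (d : ℂ)))
      = (k + 1) * (k + 2) * c ^ 2 * ((c : ℂ) * z + (d : ℂ)) ^ (k + 3) * f z
        + 2 * (k + 2) * c * ((c : ℂ) * z + (d : ℂ)) ^ (k + 4) * deriv f z
        + ((c : ℂ) * z + (d : ℂ)) ^ (k + 5) * deriv (deriv f) z := by
  have heq : ∀ᶠ w in nhds z, deriv f (((a : ℂ) * w + (b : ℂ)) / ((c : ℂ) * w + (d : ℂ)))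
      = (k + 1) * c * (((c : ℂ) * w + (d : ℂ)) ^ (k + 2) * f w)
        + ((c : ℂ) * w + (d : ℂ)) ^ (k + 3) * deriv f w := by
    filter_upwards [hfz.eventually_analyticAt, eventually_mem_upperHalf hz] with w hw hwU
    exact hf.deriv_moebius hdet hwU hw
  rw [deriv_moebius_eq hdet hz (hf.analyticAt_moebius hdet hz hfz).deriv heq
    (((hasDerivAt_denom_pow_mul c d z (k + 1) hfz).const_mul _).add
      (hasDerivAt_denom_pow_mul c d z (k + 2) hfz.deriv))]
  push_cast
  ring

theorem stmt18 (k : ℕ) (hke : Even k) (hk2 : 2 ≤ k) (f : ℂ → ℂ) (hf : IsMk k f)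
    (hf_ne : ∃ z ∈ UpperHalf, AnalyticAt ℂ f z ∧ f z ≠ 0)
    (a b c d : ℤ) (hdet : a * d - b * c = 1)
    (z : ℂ) (hz : z ∈ UpperHalf) (hfz : AnalyticAt ℂ f z) :
    let Ff : ℂ → ℂ := fun w => ((k : ℂ) + 1) * (deriv f w) ^ 2 - (k : ℂ) * f w * deriv (deriv f) w
    Ff (((a : ℂ) * z + (b : ℂ)) / ((c : ℂ) * z + (d : ℂ)))
      = ((c : ℂ) * z + (d : ℂ)) ^ (2 * k + 4) * Ff z := by
  obtain ⟨n, rfl⟩ : ∃ n, k = n + 1 := ⟨k - 1, by omega⟩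
  intro Ff
  simp only [Ff]
  rw [hf.deriv_deriv_moebius hdet hz hfz, hf.deriv_moebius hdet hz hfz,
    hf.2.2 a b c d hdet z hz hfz (hf.analyticAt_moebius hdet hz hfz)]
  push_cast
  ring
end
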